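/- arXiv:2211.14973 — 2 statements merged into one kernel-verified Lean document; each statement's English description precedes it below -/
import Mathlib

section
/- Let c >= 1, k >= 1, let t = c + 2 and d = 2, and consider the team (c,k)-nacci Zeckendorf game on n with p = 2t players partitioned into t teams of 2 consecutive players each (team j consists of players 2j - 1 and 2j). If n >= 6c^2 + 18c + 12 and t >= 2c, then no team has a winning strategy. -/
/-- The `(c,k)`-nacci numbers: `nacci c k 1 = 1`,
`nacci c k (i+1) = c * (nacci c k i + ⋯ + nacci c k 1) + 1` for `1 ≤ i ≤ k`, and
`nacci c k (i+1) = c * (nacci c k i + ⋯ + nacci c k (i-k))` for `i ≥ k + 1`.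
(The value at `0` is junk.) -/
def nacci (c k : ℕ) : ℕ → ℕ
  | 0 => 0
  | 1 => 1
  | (i + 2) =>
    if i + 1 ≤ k then
      c * ((Finset.range (i + 1)).attach.sum fun j => nacci c k (j.1 + 1)) + 1
    else
      c * ((Finset.Icc (i + 1 - k) (i + 1)).attach.sum fun j => nacci c k j.1)
decreasing_by
  · have hj := j.2
    simp only [Finset.mem_range] at hj
    omega
  · have hj := j.2
    simp only [Finset.mem_Icc] at hj
    omega


/-- The multiset consisting of `c` copies of `nacci c k j` for each `j` in the
finite set `s`. -/
def nacciBlock (c k : ℕ) (s : Finset ℕ) : Multiset ℕ :=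
  s.val.bind fun j => Multiset.replicate c (nacci c k j)

/-- A legal move of the `(c,k)`-nacci Zeckendorf game, as a relation between the
position before and the position after the move (positions are multisets of naturals). -/
def CkMove (c k : ℕ) (A B : Multiset ℕ) : Prop :=
  -- (1) for `i ≥ k+1`: `c` copies each of `S_{i-k}, …, S_i` become `S_{i+1}`
  (∃ i, k + 1 ≤ i ∧ nacciBlock c k (Finset.Icc (i - k) i) ≤ A ∧
    B = A - nacciBlock c k (Finset.Icc (i - k) i) + {nacci c k (i + 1)}) ∨
  -- (2) for `2 ≤ i ≤ k`: `c+1` copies of `S_1` and `c` copies each of `S_2, …, S_i`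
  -- become `S_{i+1}`
  (∃ i, 2 ≤ i ∧ i ≤ k ∧
    Multiset.replicate (c + 1) (nacci c k 1) + nacciBlock c k (Finset.Icc 2 i) ≤ A ∧
    B = A - (Multiset.replicate (c + 1) (nacci c k 1) + nacciBlock c k (Finset.Icc 2 i))
        + {nacci c k (i + 1)}) ∨
  -- (3) `c+1` copies of `S_1` become `S_2`
  (Multiset.replicate (c + 1) (nacci c k 1) ≤ A ∧
    B = A - Multiset.replicate (c + 1) (nacci c k 1) + {nacci c k 2}) ∨
  -- (3) for `1 < i < k+1`: `c+1` copies of `S_i` become `S_{i+1}`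
  (∃ i, 1 < i ∧ i < k + 1 ∧ Multiset.replicate (c + 1) (nacci c k i) ≤ A ∧
    B = A - Multiset.replicate (c + 1) (nacci c k i) + {nacci c k (i + 1)}) ∨
  -- (3) `c+1` copies of `S_{k+1}` become `S_{k+2}` and `S_1`
  (Multiset.replicate (c + 1) (nacci c k (k + 1)) ≤ A ∧
    B = A - Multiset.replicate (c + 1) (nacci c k (k + 1))
        + {nacci c k (k + 2), nacci c k 1}) ∨
  -- (3) for `i > k+1`: `c+1` copies of `S_i` become `S_{i+1}` and `c` copies of `S_{i-k-1}`
  (∃ i, k + 1 < i ∧ Multiset.replicate (c + 1) (nacci c k i) ≤ A ∧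
    B = A - Multiset.replicate (c + 1) (nacci c k i)
        + ({nacci c k (i + 1)} + Multiset.replicate c (nacci c k (i - k - 1))))

/-- A position is terminal when no legal move remains. -/
def Terminal (Move : Multiset ℕ → Multiset ℕ → Prop) (pos : Multiset ℕ) : Prop :=
  ∀ B, ¬ Move pos B

/-- `AllianceWins Move p team t pos`: in the `p`-player game with move relation `Move`,
where players `1, …, p` move cyclically (the mover of the `t`-th move, counting from `t = 0`,
is player `t % p + 1`) and the side making the last legal move wins, the alliance
(set of players) `team` can guarantee, from position `pos` with `t` moves already made,
that one of its members makes the last move, no matter how the other players play. -/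
inductive AllianceWins (Move : Multiset ℕ → Multiset ℕ → Prop) (p : ℕ) (team : ℕ → Prop) :
    ℕ → Multiset ℕ → Prop
  | endMove (t : ℕ) (pos B : Multiset ℕ) (hturn : team (t % p + 1)) (hmove : Move pos B)
      (hterm : Terminal Move B) : AllianceWins Move p team t pos
  | contMove (t : ℕ) (pos B : Multiset ℕ) (hturn : team (t % p + 1)) (hmove : Move pos B)
      (hwin : AllianceWins Move p team (t + 1) B) : AllianceWins Move p team t pos
  | oppMove (t : ℕ) (pos : Multiset ℕ) (hturn : ¬ team (t % p + 1))
      (hex : ∃ B, Move pos B)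
      (hall : ∀ B, Move pos B → AllianceWins Move p team (t + 1) B) :
      AllianceWins Move p team t pos

/-- Player `m` has a winning strategy in the `p`-player game on `n`
(played from `n` copies of `1`, with player 1 moving first). -/
def PlayerWins (Move : Multiset ℕ → Multiset ℕ → Prop) (p m n : ℕ) : Prop :=
  AllianceWins Move p (fun q => q = m) 0 (Multiset.replicate n 1)

/-! ### Values of the `(c,k)`-nacci numbers -/

lemma zg_S1 (c k : ℕ) : nacci c k 1 = 1 := by
  simp [nacci]

lemma zg_rec (c k i : ℕ) : nacci c k (i + 2) =
    if i + 1 ≤ k then c * (∑ j ∈ Finset.range (i + 1), nacci c k (j + 1)) + 1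
    else c * ∑ j ∈ Finset.Icc (i + 1 - k) (i + 1), nacci c k j := by
  rw [nacci]
  rw [Finset.sum_attach (Finset.range (i + 1)) (fun j => nacci c k (j + 1)),
    Finset.sum_attach (Finset.Icc (i + 1 - k) (i + 1)) (fun j => nacci c k j)]

lemma zg_S2 (c k : ℕ) (hk : 1 ≤ k) : nacci c k 2 = c + 1 := by
  have := zg_rec c k 0
  simpa [hk, zg_S1] using this

/-- From index `3` on, the numbers exceed `c + 1`. -/
lemma zg_big (c k : ℕ) (hc : 1 ≤ c) (hk : 1 ≤ k) (i : ℕ) : c + 1 < nacci c k (i + 3) := by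
  induction i using Nat.strong_induction_on with
  | _ i ih =>
    rw [show i + 3 = (i + 1) + 2 by ring, zg_rec]
    split_ifs with h
    · have h2 : ({0, 1} : Finset ℕ) ⊆ Finset.range (i + 1 + 1) := by
        intro x hx
        simp at hx ⊢
        omega
      have := Finset.sum_le_sum_of_subset (f := fun j => nacci c k (j + 1)) h2
      simp [zg_S1, zg_S2 c k hk] at this
      nlinarith
    · have h2 : ({i + 1, i + 2} : Finset ℕ) ⊆ Finset.Icc (i + 1 + 1 - k) (i + 1 + 1) := by
        intro x hx
        simp at hx ⊢
        omega
      have := Finset.sum_le_sum_of_subset (f := fun j => nacci c k j) h2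
      rw [Finset.sum_pair (by omega)] at this
      have h3 : c + 2 ≤ nacci c k (i + 1) + nacci c k (i + 2) := by
        rcases i with _ | _ | i
        · rw [zg_S1, show 0 + 2 = 2 by rfl, zg_S2 c k hk]; omega
        · have := ih 0 (by omega)
          simp only [zero_add] at this ⊢
          rw [show 1 + 2 = 3 by rfl]
          omega
        · have := ih i (by omega)
          rw [show i + 1 + 1 + 1 = i + 3 by ring]
          omega
      nlinarith

lemma zg_eq1 (c k : ℕ) (hc : 1 ≤ c) (hk : 1 ≤ k) (i : ℕ) : nacci c k i = 1 ↔ i = 1 := by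
  rcases i with _ | _ | _ | i
  · simp [nacci]
  · simp [zg_S1]
  · simp [zg_S2 c k hk]; omega
  · have : c + 1 < nacci c k (i + 1 + 1 + 1) := zg_big c k hc hk i
    constructor <;> intro h <;> omega

lemma zg_eq2 (c k : ℕ) (hc : 1 ≤ c) (hk : 1 ≤ k) (i : ℕ) : nacci c k i = c + 1 ↔ i = 2 := by
  rcases i with _ | _ | _ | i
  · simp [nacci]
  · simp [zg_S1]; omega
  · simp [zg_S2 c k hk]
  · have : c + 1 < nacci c k (i + 1 + 1 + 1) := zg_big c k hc hk i
    constructor <;> intro h <;> omega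

lemma zg_count_block (c k : ℕ) (s : Finset ℕ) (v i : ℕ) (hv : ∀ j, nacci c k j = v ↔ j = i) :
    Multiset.count v (nacciBlock c k s) = if i ∈ s then c else 0 := by
  unfold nacciBlock
  rw [Multiset.count_bind]
  have : (fun j => Multiset.count v (Multiset.replicate c (nacci c k j)))
      = fun j => if j = i then c else 0 := by
    funext j
    rw [Multiset.count_replicate]
    simp [hv]
  rw [this]
  change (∑ j ∈ s, if j = i then c else 0) = _
  simp

/-- What a full stack of `S_2` (plus possibly a spare `1`) turns into. -/
def zgX (c k : ℕ) : Multiset ℕ :=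
  if k = 1 then {nacci c k 3, 1} else {nacci c k 3}

/-! ### The three moves used by the opponents -/

lemma zg_moveM (c k : ℕ) (hk : 1 ≤ k) (R : Multiset ℕ) :
    CkMove c k (R + Multiset.replicate (c + 1) 1) (R + {c + 1}) := by
  right; right; left
  rw [zg_S1, zg_S2 c k hk]
  exact ⟨Multiset.le_add_left _ _, by rw [Multiset.add_sub_cancel_right]⟩

lemma zg_moveB (c k : ℕ) (hk : 1 ≤ k) (R : Multiset ℕ) :
    CkMove c k (R + Multiset.replicate (c + 1) (c + 1)) (R + zgX c k) := by
  right; right; right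
  by_cases h1 : k = 1
  · subst h1
    right; left
    rw [show (1:ℕ) + 1 = 2 by rfl, zg_S2 c 1 hk, zg_S1]
    refine ⟨Multiset.le_add_left _ _, ?_⟩
    rw [Multiset.add_sub_cancel_right]
    simp [zgX]
  · left
    refine ⟨2, by omega, by omega, ?_⟩
    rw [zg_S2 c k hk]
    refine ⟨Multiset.le_add_left _ _, ?_⟩
    rw [Multiset.add_sub_cancel_right]
    simp [zgX, h1]

lemma zg_moveA (c k : ℕ) (hk : 1 ≤ k) (R : Multiset ℕ) :
    CkMove c k (R + Multiset.replicate c (c + 1) + Multiset.replicate (c + 1) 1)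
      (R + zgX c k) := by
  by_cases h1 : k = 1
  · subst h1
    left
    refine ⟨2, le_rfl, ?_⟩
    have hb : nacciBlock c 1 (Finset.Icc (2 - 1) 2)
        = Multiset.replicate c 1 + Multiset.replicate c (c + 1) := by
      have : Finset.Icc (2 - 1) 2 = ({1, 2} : Finset ℕ) := by decide
      rw [this]
      have h : ({1, 2} : Finset ℕ).val = 1 ::ₘ 2 ::ₘ 0 := rfl
      simp [nacciBlock, h, zg_S1, zg_S2]
    have hA : R + Multiset.replicate c (c + 1) + Multiset.replicate (c + 1) 1
        = (R + {1}) + nacciBlock c 1 (Finset.Icc (2 - 1) 2) := by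
      rw [hb, Multiset.replicate_succ, ← Multiset.singleton_add]
      abel
    rw [hA]
    refine ⟨Multiset.le_add_left _ _, ?_⟩
    rw [Multiset.add_sub_cancel_right]
    simp only [zgX, if_true]
    rw [add_assoc, Multiset.insert_eq_cons, ← Multiset.singleton_add, add_comm {1}]
  · right; left
    refine ⟨2, le_rfl, by omega, ?_⟩
    have hb : nacciBlock c k (Finset.Icc 2 2) = Multiset.replicate c (c + 1) := by
      simp [nacciBlock, zg_S2 c k hk]
    rw [hb, zg_S1]
    have hA : R + Multiset.replicate c (c + 1) + Multiset.replicate (c + 1) 1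
        = R + (Multiset.replicate (c + 1) 1 + Multiset.replicate c (c + 1)) := by abel
    rw [hA]
    refine ⟨Multiset.le_add_left _ _, ?_⟩
    rw [Multiset.add_sub_cancel_right]
    simp [zgX, h1]

/-! ### Effect of an arbitrary move on the numbers of `S_1` and `S_2` -/

lemma zg_class (c k : ℕ) (hc : 1 ≤ c) (hk : 1 ≤ k) (A B : Multiset ℕ) (h : CkMove c k A B) :
    (Multiset.replicate (c + 1) (c + 1) ≤ A ∧
      B = A - Multiset.replicate (c + 1) (c + 1) + zgX c k) ∨
    (A.count (c + 1) ≤ B.count (c + 1) + c ∧ A.count 1 ≤ B.count 1 + (c + 1)) := by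
  have e1 := zg_eq1 c k hc hk
  have e2 := zg_eq2 c k hc hk
  have hne : c + 1 ≠ 1 := by omega
  rcases h with ⟨i, hi, -, rfl⟩ | ⟨i, hi, hik, -, rfl⟩ | ⟨-, rfl⟩ | ⟨i, hi, hik, hA, rfl⟩ |
    ⟨hA, rfl⟩ | ⟨i, hi, -, rfl⟩
  · right
    simp only [Multiset.count_add, Multiset.count_sub, zg_count_block c k _ _ _ e1,
      zg_count_block c k _ _ _ e2]
    constructor <;> split_ifs <;> omega
  · right
    simp only [Multiset.count_add, Multiset.count_sub, zg_count_block c k _ _ _ e1,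
      zg_count_block c k _ _ _ e2, Multiset.count_replicate, e1, e2]
    constructor <;> (try simp) <;> (try split_ifs) <;> omega
  · right
    simp only [Multiset.count_add, Multiset.count_sub, Multiset.count_replicate, e1, e2]
    constructor <;> (try simp) <;> omega
  · by_cases h2 : i = 2
    · subst h2
      left
      rw [zg_S2 c k hk] at hA ⊢
      refine ⟨hA, ?_⟩
      have : k ≠ 1 := by omega
      simp [zgX, this]
    · right
      simp only [Multiset.count_add, Multiset.count_sub, Multiset.count_replicate, e1, e2]
      constructor <;> (try simp [h2]) <;> (try split_ifs) <;> omega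
  · by_cases h2 : k = 1
    · subst h2
      left
      rw [show (1:ℕ) + 1 = 2 by rfl, zg_S2 c 1 hk] at hA ⊢
      refine ⟨hA, ?_⟩
      simp [zgX, zg_S1]
    · right
      simp only [Multiset.count_add, Multiset.count_sub, Multiset.count_replicate, e1, e2]
      have h3 : ¬ (k + 1 = 2) := by omega
      constructor <;> (try simp [h3]) <;> (try split_ifs) <;> omega
  · right
    simp only [Multiset.count_add, Multiset.count_sub, Multiset.count_replicate, e1, e2]
    have h3 : ¬ (i = 2) := by omega
    have h4 : ¬ (i = 1) := by omega
    constructor <;> (try simp [h3, h4]) <;> (try split_ifs) <;> omega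

lemma zg_class' (c k : ℕ) (hc : 1 ≤ c) (hk : 1 ≤ k) (A B : Multiset ℕ) (h : CkMove c k A B) :
    (Multiset.replicate (c + 1) (c + 1) ≤ A ∧
      B = A - Multiset.replicate (c + 1) (c + 1) + zgX c k ∧
      A.count (c + 1) ≤ B.count (c + 1) + (c + 1) ∧ A.count 1 ≤ B.count 1) ∨
    (A.count (c + 1) ≤ B.count (c + 1) + c ∧ A.count 1 ≤ B.count 1 + (c + 1)) := by
  rcases zg_class c k hc hk A B h with ⟨h1, h2⟩ | h1
  · left
    refine ⟨h1, h2, ?_, ?_⟩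
    · rw [h2]
      simp only [Multiset.count_add, Multiset.count_sub, Multiset.count_replicate]
      simp
      omega
    · rw [h2]
      have hne : c + 1 ≠ 1 := by omega
      simp only [Multiset.count_add, Multiset.count_sub, Multiset.count_replicate, if_neg hne]
      omega
  · right; exact h1

/-! ### Sequences of moves -/

/-- `ZgReach c k m A B`: some sequence of exactly `m` legal moves leads from `A` to `B`. -/
inductive ZgReach (c k : ℕ) : ℕ → Multiset ℕ → Multiset ℕ → Prop
  | refl (A : Multiset ℕ) : ZgReach c k 0 A A
  | step (m : ℕ) (A B C : Multiset ℕ) (h : CkMove c k A B) (hr : ZgReach c k m B C) :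
      ZgReach c k (m + 1) A C

lemma ZgReach.append {c k m l : ℕ} {A B C : Multiset ℕ} (h : ZgReach c k m A B)
    (h' : ZgReach c k l B C) : ZgReach c k (m + l) A C := by
  induction h with
  | refl A => simpa using h'
  | step m A B C' hm hr ih =>
    rw [show m + 1 + l = (m + l) + 1 by ring]
    exact .step _ _ _ _ hm (ih h')

lemma ZgReach.single {c k : ℕ} {A B : Multiset ℕ} (h : CkMove c k A B) : ZgReach c k 1 A B :=
  .step _ _ _ _ h (.refl _)

lemma zg_reachM (c k : ℕ) (hk : 1 ≤ k) (x : ℕ) (R : Multiset ℕ) :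
    ZgReach c k x (R + Multiset.replicate (x * (c + 1)) 1) (R + Multiset.replicate x (c + 1)) := by
  induction x generalizing R with
  | zero => simpa using ZgReach.refl R
  | succ x ih =>
    have h1 : R + Multiset.replicate ((x + 1) * (c + 1)) 1
        = (R + Multiset.replicate (x * (c + 1)) 1) + Multiset.replicate (c + 1) 1 := by
      rw [add_mul, one_mul, Multiset.replicate_add, add_assoc]
    have h2 : R + Multiset.replicate (x + 1) (c + 1)
        = (R + {c + 1}) + Multiset.replicate x (c + 1) := by
      rw [Multiset.replicate_succ, ← Multiset.singleton_add, add_assoc]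
    rw [h1, h2]
    refine .step _ _ _ _ (zg_moveM c k hk _) ?_
    have := ih (R + {c + 1})
    rwa [add_right_comm] at this

/-- Two short conversions. -/
lemma zg_reachAA (c k : ℕ) (hk : 1 ≤ k) (R : Multiset ℕ) :
    ZgReach c k 2 (R + Multiset.replicate (2 * c) (c + 1) + Multiset.replicate (2 * (c + 1)) 1)
      (R + zgX c k + zgX c k) := by
  refine .step _ _ (R + Multiset.replicate c (c + 1) + Multiset.replicate (c + 1) 1
    + zgX c k) _ ?_ (.single ?_)
  · have := zg_moveA c k hk (R + Multiset.replicate c (c + 1) + Multiset.replicate (c + 1) 1)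
    convert this using 1
    rw [two_mul c, two_mul (c + 1), Multiset.replicate_add c c, Multiset.replicate_add (c + 1) (c + 1)]
    abel
  · have := zg_moveA c k hk (R + zgX c k)
    convert this using 1
    abel

/-- The same conversions, done slowly. -/
lemma zg_reachMBMB (c k : ℕ) (hk : 1 ≤ k) (R : Multiset ℕ) :
    ZgReach c k 4 (R + Multiset.replicate (2 * c) (c + 1) + Multiset.replicate (2 * (c + 1)) 1)
      (R + zgX c k + zgX c k) := by
  have hs : Multiset.replicate (c + 1) (c + 1) = Multiset.replicate c (c + 1) + {c + 1} := by
    rw [Multiset.replicate_succ, ← Multiset.singleton_add, add_comm]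
  refine .step _ _ (R + Multiset.replicate c (c + 1) + Multiset.replicate (c + 1) 1
      + Multiset.replicate (c + 1) (c + 1)) _ ?_
    (.step _ _ _ _ (zg_moveB c k hk _)
    (.step _ _ (R + zgX c k + Multiset.replicate (c + 1) (c + 1)) _ ?_
    (.single (zg_moveB c k hk _))))
  · have := zg_moveM c k hk (R + Multiset.replicate (2 * c) (c + 1) + Multiset.replicate (c + 1) 1)
    convert this using 1
    · rw [two_mul (c + 1), Multiset.replicate_add (c + 1)]
      abel
    · rw [hs, two_mul, Multiset.replicate_add c c]
      abel
  · have := zg_moveM c k hk (R + Multiset.replicate c (c + 1) + zgX c k)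
    convert this using 1
    · abel
    · rw [hs]
      abel

/-! ### Generalities on alliances -/

lemma zg_not_terminal {Move : Multiset ℕ → Multiset ℕ → Prop} {p : ℕ} {team : ℕ → Prop} {a : ℕ}
    {P : Multiset ℕ} (h : AllianceWins Move p team a P) : ¬ Terminal Move P := by
  intro hT
  cases h with
  | endMove _ _ B hturn hmove hterm => exact hT _ hmove
  | contMove _ _ B hturn hmove hwin => exact hT _ hmove
  | oppMove _ _ hturn hex hall => exact hT _ hex.choose_spec

/-- Two disjoint alliances cannot both win. -/
lemma zg_conflict {Move : Multiset ℕ → Multiset ℕ → Prop} {p : ℕ} {team : ℕ → Prop}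
    (hd : ∀ a, team (a % p + 1) → ¬ team ((a + 2) % p + 1)) {a : ℕ} {P : Multiset ℕ}
    (h : AllianceWins Move p team a P) (h' : AllianceWins Move p team (a + 2) P) : False := by
  induction h with
  | endMove t P B hturn hmove hterm =>
    cases h' with
    | endMove _ _ B' hturn' _ _ => exact hd _ hturn hturn'
    | contMove _ _ B' hturn' _ _ => exact hd _ hturn hturn'
    | oppMove _ _ _ _ hall => exact zg_not_terminal (hall _ hmove) hterm
  | contMove t P B hturn hmove hwin ih =>
    cases h' with
    | endMove _ _ B' hturn' _ _ => exact hd _ hturn hturn'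
    | contMove _ _ B' hturn' _ _ => exact hd _ hturn hturn'
    | oppMove _ _ _ _ hall =>
      apply ih
      have := hall _ hmove
      rwa [show t + 1 + 2 = t + 2 + 1 by ring]
  | oppMove t P hturn hex hall ih =>
    cases h' with
    | endMove _ _ B' hturn' hmove' hterm' => exact zg_not_terminal (hall _ hmove') hterm'
    | contMove _ _ B' hturn' hmove' hwin' =>
      apply ih _ hmove'
      rwa [show t + 1 + 2 = t + 2 + 1 by ring]
    | oppMove _ _ _ hex' hall' =>
      obtain ⟨B, hB⟩ := hex
      apply ih _ hB
      have := hall' _ hB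
      rwa [show t + 1 + 2 = t + 2 + 1 by ring]

lemma zg_run {c k p : ℕ} {team : ℕ → Prop} {m : ℕ} {P Q : Multiset ℕ}
    (hr : ZgReach c k m P Q) : ∀ {a : ℕ}, (∀ i < m, ¬ team ((a + i) % p + 1)) →
      AllianceWins (CkMove c k) p team a P → AllianceWins (CkMove c k) p team (a + m) Q := by
  induction hr with
  | refl A => intro a _ h; exact h
  | step m A B C hm hr ih =>
    intro a ht h
    have h0 := ht 0 (by omega)
    rw [add_zero] at h0
    have hB : AllianceWins (CkMove c k) p team (a + 1) B := by
      cases h with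
      | endMove _ _ B' hturn' _ _ => exact absurd hturn' h0
      | contMove _ _ B' hturn' _ _ => exact absurd hturn' h0
      | oppMove _ _ _ _ hall => exact hall _ hm
    have := ih (a := a + 1) (fun i hi => by
      have := ht (i + 1) (by omega)
      rwa [show a + 1 + i = a + (i + 1) by ring]) hB
    rwa [show a + (m + 1) = a + 1 + m by ring]

lemma zg_ones_move {c k : ℕ} {P : Multiset ℕ} (h : c + 1 ≤ P.count 1) :
    ¬ Terminal (CkMove c k) P := by
  intro hT
  refine hT _ (Or.inr (Or.inr (Or.inl ⟨?_, rfl⟩)))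
  rw [zg_S1]
  exact Multiset.le_count_iff_replicate_le.1 h

lemma zg_ones_le {c k : ℕ} (hc : 1 ≤ c) (hk : 1 ≤ k) {A B : Multiset ℕ} (h : CkMove c k A B) :
    A.count 1 ≤ B.count 1 + (c + 1) := by
  rcases zg_class' c k hc hk A B h with h | h <;> omega

lemma zg_team1 {c k p : ℕ} (hc : 1 ≤ c) (hk : 1 ≤ k) {team : ℕ → Prop} {a : ℕ} {P : Multiset ℕ}
    (ht : team (a % p + 1)) (hu : 2 * (c + 1) ≤ P.count 1)
    (h : AllianceWins (CkMove c k) p team a P) :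
    ∃ B, CkMove c k P B ∧ AllianceWins (CkMove c k) p team (a + 1) B := by
  cases h with
  | endMove _ _ B _ hm hterm =>
    have := zg_ones_le hc hk hm
    exact absurd hterm (zg_ones_move (by omega))
  | contMove _ _ B _ hm hw => exact ⟨B, hm, hw⟩
  | oppMove _ _ hturn _ _ => exact absurd ht hturn

lemma zg_team2 {c k p : ℕ} (hc : 1 ≤ c) (hk : 1 ≤ k) {team : ℕ → Prop} {a : ℕ} {P : Multiset ℕ}
    (ht : team (a % p + 1)) (ht' : team ((a + 1) % p + 1)) (hu : 3 * (c + 1) ≤ P.count 1)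
    (h : AllianceWins (CkMove c k) p team a P) :
    ∃ B C, CkMove c k P B ∧ CkMove c k B C ∧ AllianceWins (CkMove c k) p team (a + 2) C := by
  obtain ⟨B, hB, hw⟩ := zg_team1 hc hk ht (by omega) h
  have := zg_ones_le hc hk hB
  obtain ⟨C, hC, hw'⟩ := zg_team1 hc hk ht' (by omega) hw
  exact ⟨B, C, hB, hC, hw'⟩

/-- Split off ones and `S_2`s. -/
lemma zg_split (P : Multiset ℕ) (v x y : ℕ) (hv : v ≠ 1) (hx : x ≤ P.count v)
    (hy : y ≤ P.count 1) :
    ∃ R, P = R + Multiset.replicate x v + Multiset.replicate y 1 := by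
  have : Multiset.replicate x v + Multiset.replicate y 1 ≤ P := by
    rw [Multiset.le_iff_count]
    intro a
    rw [Multiset.count_add, Multiset.count_replicate, Multiset.count_replicate]
    split_ifs with h1 h2 h2 <;> subst_vars <;> omega
  obtain ⟨R, hR⟩ := Multiset.le_iff_exists_add.1 this
  exact ⟨R, by rw [hR]; abel⟩

/-- With two copies of `S_2` at the start of the opponents' block, the team cannot win. -/
lemma zg_final {c k p : ℕ} (hc : 1 ≤ c) (hk : 1 ≤ k) {team : ℕ → Prop}
    (hd : ∀ a, team (a % p + 1) → ¬ team ((a + 2) % p + 1)) {a : ℕ} {P : Multiset ℕ}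
    (hopp : ∀ i < 2 * c + 2, ¬ team ((a + i) % p + 1))
    (hs : 2 ≤ P.count (c + 1)) (hu : (2 * c - P.count (c + 1) + 2) * (c + 1) ≤ P.count 1)
    (h : AllianceWins (CkMove c k) p team a P) : False := by
  obtain ⟨x, hx⟩ : ∃ x, x = 2 * c - P.count (c + 1) := ⟨_, rfl⟩
  rw [← hx] at hu
  obtain ⟨R, hR⟩ := zg_split P (c + 1) (2 * c - x) ((x + 2) * (c + 1)) (by omega) (by omega) hu
  have hM : ZgReach c k x P
      (R + Multiset.replicate (2 * c) (c + 1) + Multiset.replicate (2 * (c + 1)) 1) := by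
    have := zg_reachM c k hk x (R + Multiset.replicate (2 * c - x) (c + 1)
      + Multiset.replicate (2 * (c + 1)) 1)
    convert this using 1
    · rw [hR, add_mul, Multiset.replicate_add (x * (c + 1))]
      abel
    · have : Multiset.replicate (2 * c) (c + 1)
          = Multiset.replicate (2 * c - x) (c + 1) + Multiset.replicate x (c + 1) := by
        rw [← Multiset.replicate_add]
        congr 1
        omega
      rw [this]
      abel
  have g0 := zg_run (hM.append (zg_reachAA c k hk R)) (fun i hi => hopp i (by omega)) h
  have g1 := zg_run (hM.append (zg_reachMBMB c k hk R)) (fun i hi => hopp i (by omega)) h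
  exact zg_conflict hd g0 g1

/-- One full round: the number of `S_2` can be made to grow. -/
lemma zg_round {c k p : ℕ} (hc : 1 ≤ c) (hk : 1 ≤ k) {team : ℕ → Prop}
    (hd : ∀ a, team (a % p + 1) → ¬ team ((a + 2) % p + 1)) {a : ℕ} {P : Multiset ℕ}
    (hopp : ∀ i < 2 * c + 2, ¬ team ((a + i) % p + 1))
    (ht : team ((a + (2 * c + 2)) % p + 1)) (ht' : team ((a + (2 * c + 2) + 1) % p + 1))
    (hu : (2 * c + 2) * (c + 1) + 3 * (c + 1) ≤ P.count 1)
    (h : AllianceWins (CkMove c k) p team a P) :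
    ∃ Q, AllianceWins (CkMove c k) p team (a + (2 * c + 2) + 2) Q ∧
      ((P.count (c + 1) + 2 ≤ Q.count (c + 1) ∧
        P.count 1 ≤ Q.count 1 + (2 * c + 2) * (c + 1) + 2 * (c + 1)) ∨
       (P.count (c + 1) + 1 ≤ Q.count (c + 1) ∧
        P.count 1 ≤ Q.count 1 + (2 * c + 2) * (c + 1) + (c + 1))) := by
  obtain ⟨R, hR⟩ := zg_split P (c + 1) 0 ((2 * c + 2) * (c + 1)) (by omega) (by omega) (by omega)
  rw [Multiset.replicate_zero, add_zero] at hR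
  have hM := zg_reachM c k hk (2 * c + 2) R
  rw [← hR] at hM
  have w := zg_run hM hopp h
  have hne : (1 : ℕ) ≠ c + 1 := by omega
  have c1 : P.count 1 = R.count 1 + (2 * c + 2) * (c + 1) := by
    rw [hR]; simp
  have c2 : P.count (c + 1) = R.count (c + 1) := by
    rw [hR, Multiset.count_add, Multiset.count_replicate, if_neg hne, add_zero]
  have d1 : (R + Multiset.replicate (2 * c + 2) (c + 1)).count 1 = R.count 1 := by
    rw [Multiset.count_add, Multiset.count_replicate, if_neg hne.symm, add_zero]
  have d2 : (R + Multiset.replicate (2 * c + 2) (c + 1)).count (c + 1)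
      = R.count (c + 1) + (2 * c + 2) := by
    rw [Multiset.count_add, Multiset.count_replicate_self]
  obtain ⟨B, C, hB, hC, hw⟩ := zg_team2 hc hk ht ht' (by omega) w
  refine ⟨C, hw, ?_⟩
  rcases zg_class' c k hc hk _ _ hB with ⟨-, eB, b1, b2⟩ | ⟨b1, b2⟩ <;>
  rcases zg_class' c k hc hk _ _ hC with ⟨-, eC, b3, b4⟩ | ⟨b3, b4⟩
  · exfalso
    have e1 : R + Multiset.replicate (2 * c + 2) (c + 1)
        = R + Multiset.replicate (c + 1) (c + 1) + Multiset.replicate (c + 1) (c + 1) := by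
      rw [show 2 * c + 2 = (c + 1) + (c + 1) by ring, Multiset.replicate_add (c + 1), add_assoc]
    rw [e1, Multiset.add_sub_cancel_right] at eB
    rw [eB, add_right_comm, Multiset.add_sub_cancel_right] at eC
    have hM2 := zg_reachM c k hk (2 * c) (R + Multiset.replicate (2 * (c + 1)) 1)
    have e2 : R + Multiset.replicate (2 * (c + 1)) 1 + Multiset.replicate (2 * c * (c + 1)) 1
        = P := by
      rw [hR, add_mul, Multiset.replicate_add (2 * c * (c + 1))]
      abel
    rw [e2, add_right_comm] at hM2
    have g := zg_run (hM2.append (zg_reachAA c k hk R)) hopp h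
    rw [← eC] at g
    exact zg_conflict hd g hw
  · right; omega
  · right; omega
  · left; omega

/-- Several rounds: enough ones at the start of the opponents' block refute a win. -/
lemma zg_rounds {c k p : ℕ} (hc2 : c = 1 ∨ c = 2) (hk : 1 ≤ k) {team : ℕ → Prop}
    (hd : ∀ a, team (a % p + 1) → ¬ team ((a + 2) % p + 1)) {r : ℕ}
    (hp : p = 2 * c + 4)
    (hopp : ∀ a, a % p = r → ∀ i < 2 * c + 2, ¬ team ((a + i) % p + 1))
    (ht : ∀ a, a % p = r → team ((a + (2 * c + 2)) % p + 1))
    (ht' : ∀ a, a % p = r → team ((a + (2 * c + 2) + 1) % p + 1))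
    {a : ℕ} {P : Multiset ℕ} (ha : a % p = r)
    (hu : (c = 1 → 28 ≤ P.count 1) ∧ (c = 2 → 54 ≤ P.count 1))
    (h : AllianceWins (CkMove c k) p team a P) : False := by
  have hc : 1 ≤ c := by omega
  have hnext : ∀ a, a % p = r → (a + (2 * c + 2) + 2) % p = r := by
    intro a ha
    rw [show a + (2 * c + 2) + 2 = a + p by omega, Nat.add_mod_right, ha]
  have ones : (2 * c + 2) * (c + 1) + 3 * (c + 1) ≤ P.count 1 := by
    rcases hc2 with rfl | rfl <;> omega
  obtain ⟨Q, hQ, hQc⟩ := zg_round hc hk hd (hopp a ha) (ht a ha) (ht' a ha) ones h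
  have ha1 := hnext a ha
  by_cases hQ2 : 2 ≤ Q.count (c + 1)
  · refine zg_final hc hk hd (hopp _ ha1) hQ2 ?_ hQ
    rcases hc2 with rfl | rfl <;> omega
  have ones' : (2 * c + 2) * (c + 1) + 3 * (c + 1) ≤ Q.count 1 := by
    rcases hc2 with rfl | rfl <;> omega
  obtain ⟨Q', hQ', hQc'⟩ := zg_round hc hk hd (hopp _ ha1) (ht _ ha1) (ht' _ ha1) ones' hQ
  refine zg_final hc hk hd (hopp _ (hnext _ ha1)) (by omega) ?_ hQ'
  rcases hc2 with rfl | rfl <;> omega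

theorem team_ck_nacci_no_winner_pairs (c k t n : ℕ)
    (hc : 1 ≤ c) (hk : 1 ≤ k) (ht : t = c + 2)
    (hn : 6 * c ^ 2 + 18 * c + 12 ≤ n) (ht2 : 2 * c ≤ t) :
    ∀ j, 1 ≤ j → j ≤ t →
      ¬ AllianceWins (CkMove c k) (2 * t)
          (fun q => q = 2 * j - 1 ∨ q = 2 * j) 0 (Multiset.replicate n 1) := by
  intro j hj hjt h
  have hc2 : c = 1 ∨ c = 2 := by omega
  have hn2 : (c = 1 → 36 ≤ n) ∧ (c = 2 → 72 ≤ n) := by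
    constructor <;> rintro rfl <;> omega
  subst ht
  have hd : ∀ a, (fun q => q = 2 * j - 1 ∨ q = 2 * j) (a % (2 * (c + 2)) + 1) →
      ¬ (fun q => q = 2 * j - 1 ∨ q = 2 * j) ((a + 2) % (2 * (c + 2)) + 1) := by
    intro a
    rcases hc2 with rfl | rfl <;> (try simp only) <;> omega
  have hopp : ∀ a, a % (2 * (c + 2)) = 2 * j % (2 * (c + 2)) → ∀ i < 2 * c + 2,
      ¬ (fun q => q = 2 * j - 1 ∨ q = 2 * j) ((a + i) % (2 * (c + 2)) + 1) := by
    intro a ha i hi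
    rcases hc2 with rfl | rfl <;> (try simp only) <;> omega
  have hT : ∀ a, a % (2 * (c + 2)) = 2 * j % (2 * (c + 2)) →
      (fun q => q = 2 * j - 1 ∨ q = 2 * j) ((a + (2 * c + 2)) % (2 * (c + 2)) + 1) := by
    intro a ha
    rcases hc2 with rfl | rfl <;> (try simp only) <;> omega
  have hT' : ∀ a, a % (2 * (c + 2)) = 2 * j % (2 * (c + 2)) →
      (fun q => q = 2 * j - 1 ∨ q = 2 * j) ((a + (2 * c + 2) + 1) % (2 * (c + 2)) + 1) := by
    intro a ha
    rcases hc2 with rfl | rfl <;> (try simp only) <;> omega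
  have key := fun (a : ℕ) (P : Multiset ℕ) => zg_rounds (a := a) (P := P) (p := 2 * (c + 2))
    (team := fun q => q = 2 * j - 1 ∨ q = 2 * j) hc2 hk hd (by ring)
    hopp hT hT'
  by_cases hjl : j = c + 2
  · subst hjl
    refine key 0 _ (by simp) ?_ h
    rw [Multiset.count_replicate_self]
    omega
  · have hb : (2 * j - 2) * (c + 1) + 3 * (c + 1) ≤ n ∧
        ((c = 1 → 28 + (2 * j - 2) * (c + 1) + 2 * (c + 1) ≤ n) ∧
         (c = 2 → 54 + (2 * j - 2) * (c + 1) + 2 * (c + 1) ≤ n)) := by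
      rcases hc2 with rfl | rfl <;> omega
    obtain ⟨m, hm⟩ : ∃ m, n = m + (2 * j - 2) * (c + 1) :=
      ⟨n - (2 * j - 2) * (c + 1), by omega⟩
    have hM := zg_reachM c k hk (2 * j - 2) (Multiset.replicate m 1)
    rw [← Multiset.replicate_add, ← hm] at hM
    have w := zg_run hM (fun i hi => by
      rcases hc2 with rfl | rfl <;> (try simp only) <;> omega) h
    have hne : c + 1 ≠ 1 := by omega
    have d1 : (Multiset.replicate m 1 + Multiset.replicate (2 * j - 2) (c + 1)).count 1 = m := by
      rw [Multiset.count_add, Multiset.count_replicate, Multiset.count_replicate, if_neg hne]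
      simp
    obtain ⟨B, C, hB, hC, hw⟩ := zg_team2 hc hk
      (by rcases hc2 with rfl | rfl <;> (try simp only) <;> omega)
      (by rcases hc2 with rfl | rfl <;> (try simp only) <;> omega) (by omega) w
    have o1 := zg_ones_le hc hk hB
    have o2 := zg_ones_le hc hk hC
    refine key _ C ?_ ?_ hw
    · congr 1
      omega
    · omega
end

section
/- Let p >= 6, c = 1, and k >= 1, and consider the team (1,k)-nacci Zeckendorf game on n with p players partitioned into exactly two teams, one with p - 2 players and the other with 2 players. Then for every n >= 36, the team with p - 2 players has a winning strategy. -/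
/-! ### Arithmetic of the nacci numbers -/

theorem nacci_one' (k : ℕ) : nacci 1 k 1 = 1 := by
  rw [nacci]

theorem nacci_rec_low (k i : ℕ) (hi : i + 1 ≤ k) :
    nacci 1 k (i + 2) = (∑ j ∈ Finset.range (i + 1), nacci 1 k (j + 1)) + 1 := by
  rw [nacci, if_pos hi, one_mul, Finset.sum_attach (Finset.range (i + 1)) (fun j => nacci 1 k (j + 1))]

theorem nacci_rec_high (k i : ℕ) (hi : k + 1 ≤ i) :
    nacci 1 k (i + 1) = ∑ j ∈ Finset.Icc (i - k) i, nacci 1 k j := by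
  obtain ⟨m, rfl⟩ : ∃ m, i = m + 1 := ⟨i - 1, by omega⟩
  rw [nacci, if_neg (by omega), one_mul,
    Finset.sum_attach (Finset.Icc (m + 1 - k) (m + 1)) (fun j => nacci 1 k j)]

theorem nacci_double (k i : ℕ) (h1 : 1 ≤ i) (hi : i ≤ k) :
    nacci 1 k (i + 1) = 2 * nacci 1 k i := by
  obtain ⟨m, rfl⟩ : ∃ m, i = m + 1 := ⟨i - 1, by omega⟩
  rw [nacci_rec_low k m hi]
  rcases m with _ | m
  · simp [nacci_one']
  · rw [Finset.sum_range_succ, nacci_rec_low k m (by omega)]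
    ring

theorem nacci_two' (k : ℕ) (hk : 1 ≤ k) : nacci 1 k 2 = 2 := by
  rw [nacci_double k 1 le_rfl hk, nacci_one']

theorem nacci_pos (k : ℕ) : ∀ i, 1 ≤ i → 0 < nacci 1 k i := by
  intro i
  induction i using Nat.strong_induction_on with
  | _ i ih =>
    intro hi
    by_cases h1 : i = 1
    · subst h1; rw [nacci_one']; norm_num
    obtain ⟨m, rfl⟩ : ∃ m, i = m + 1 := ⟨i - 1, by omega⟩
    by_cases hm : m ≤ k
    · rw [nacci_double k m (by omega) hm]
      have := ih m (by omega) (by omega)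
      omega
    · rw [nacci_rec_high k m (by omega)]
      have h := ih m (by omega) (by omega)
      have := Finset.single_le_sum (f := fun j => nacci 1 k j) (s := Finset.Icc (m - k) m)
        (fun _ _ => Nat.zero_le _) (Finset.mem_Icc.2 ⟨by omega, le_refl m⟩)
      omega

theorem nacci_lt_succ (k : ℕ) (hk : 1 ≤ k) (i : ℕ) (hi : 1 ≤ i) :
    nacci 1 k i < nacci 1 k (i + 1) := by
  have hp := nacci_pos k i hi
  by_cases hik : i ≤ k
  · rw [nacci_double k i hi hik]; omega
  · rw [nacci_rec_high k i (by omega)]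
    have hsub : ({i - 1, i} : Finset ℕ) ⊆ Finset.Icc (i - k) i := by
      intro x hx
      simp only [Finset.mem_insert, Finset.mem_singleton] at hx
      rw [Finset.mem_Icc]; omega
    have h := Finset.sum_le_sum_of_subset (f := fun j => nacci 1 k j) hsub
    rw [Finset.sum_pair (by omega)] at h
    have := nacci_pos k (i - 1) (by omega)
    omega

theorem nacci_lt (k : ℕ) (hk : 1 ≤ k) (i j : ℕ) (hi : 1 ≤ i) (hij : i < j) :
    nacci 1 k i < nacci 1 k j := by
  induction j, hij using Nat.le_induction with
  | base => exact nacci_lt_succ k hk i hi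
  | succ m hm ih => exact ih.trans (nacci_lt_succ k hk m (by omega))

theorem nacci_inj (k : ℕ) (hk : 1 ≤ k) (i j : ℕ) (hi : 1 ≤ i) (hj : 1 ≤ j)
    (h : nacci 1 k i = nacci 1 k j) : i = j := by
  rcases lt_trichotomy i j with h' | h' | h'
  · have := nacci_lt k hk i j hi h'; omega
  · exact h'
  · have := nacci_lt k hk j i hj h'; omega

theorem nacci_split_base (k : ℕ) (hk : 1 ≤ k) :
    2 * nacci 1 k (k + 1) = nacci 1 k (k + 2) + nacci 1 k 1 := by
  rw [nacci_rec_high k (k + 1) le_rfl, nacci_one']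
  obtain ⟨m, rfl⟩ : ∃ m, k = m + 1 := ⟨k - 1, by omega⟩
  have h : nacci 1 (m + 1) (m + 1 + 1) = _ := nacci_rec_low (m + 1) m le_rfl
  have h2 : ∑ j ∈ Finset.Icc (m + 1 + 1 - (m + 1)) (m + 1 + 1), nacci 1 (m + 1) j
      = ∑ j ∈ Finset.range (m + 2), nacci 1 (m + 1) (j + 1) := by
    rw [Finset.range_eq_Ico, Finset.sum_Ico_add' (fun j => nacci 1 (m + 1) j) 0 (m + 2) 1]
    apply Finset.sum_congr _ (fun _ _ => rfl)
    ext x; simp only [Finset.mem_Icc, Finset.mem_Ico]; omega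
  rw [h2, Finset.sum_range_succ]
  omega

theorem nacci_split_high (k i : ℕ) (hi : k + 1 < i) :
    2 * nacci 1 k i = nacci 1 k (i + 1) + nacci 1 k (i - k - 1) := by
  obtain ⟨m, rfl⟩ : ∃ m, i = m + 1 := ⟨i - 1, by omega⟩
  rw [nacci_rec_high k (m + 1) (by omega)]
  have e1 : m + 1 - k - 1 = m - k := by omega
  have e2 : m + 1 - k = (m - k) + 1 := by omega
  rw [e1, e2, Finset.sum_Icc_succ_top (by omega)]
  have h := nacci_rec_high k m (by omega)
  have h2 := Finset.sum_Ioc_add_eq_sum_Icc (f := fun j => nacci 1 k j) (a := m - k) (b := m) (by omega)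
  have h3 : Finset.Icc (m - k + 1) m = Finset.Ioc (m - k) m := by
    ext x; simp only [Finset.mem_Icc, Finset.mem_Ioc]; omega
  rw [h3]
  omega

theorem nacci_sum_low (k i : ℕ) (h2 : 2 ≤ i) (hi : i ≤ k) :
    nacci 1 k (i + 1) = 2 * nacci 1 k 1 + ∑ j ∈ Finset.Icc 2 i, nacci 1 k j := by
  obtain ⟨m, rfl⟩ : ∃ m, i = m + 1 := ⟨i - 1, by omega⟩
  rw [nacci_rec_low k m hi, Finset.sum_range_succ']
  have : ∑ j ∈ Finset.Icc 2 (m + 1), nacci 1 k j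
      = ∑ j ∈ Finset.range m, nacci 1 k (j + 1 + 1) := by
    rw [Finset.range_eq_Ico]
    have := Finset.sum_Ico_add' (fun j => nacci 1 k j) 0 m 2
    rw [show (fun j => nacci 1 k (j + 1 + 1)) = fun j => nacci 1 k (j + 2) from rfl, this]
    apply Finset.sum_congr _ (fun _ _ => rfl)
    ext x; simp only [Finset.mem_Icc, Finset.mem_Ico]; omega
  rw [this, nacci_one']
  simp [nacci_one']
  omega

/-! ### Blocks -/

theorem block_eq (k : ℕ) (s : Finset ℕ) : nacciBlock 1 k s = s.val.map (nacci 1 k) := by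
  unfold nacciBlock
  simp [Multiset.replicate_one, Multiset.bind_singleton]

theorem block_sum (k : ℕ) (s : Finset ℕ) :
    (nacciBlock 1 k s).sum = ∑ j ∈ s, nacci 1 k j := by
  rw [block_eq]; rfl

theorem block_count (k : ℕ) (hk : 1 ≤ k) (s : Finset ℕ) (hs : ∀ j ∈ s, 1 ≤ j) (v : ℕ) :
    (nacciBlock 1 k s).count v ≤ 1 := by
  rw [block_eq]
  apply Multiset.nodup_iff_count_le_one.1
  exact Multiset.Nodup.map_on
    (fun x hx y hy h => nacci_inj k hk x y (hs x hx) (hs y hy) h) s.nodup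

theorem block_pos (k : ℕ) (s : Finset ℕ) (hs : ∀ j ∈ s, 1 ≤ j) :
    ∀ x ∈ nacciBlock 1 k s, 0 < x := by
  intro x hx
  rw [block_eq, Multiset.mem_map] at hx
  obtain ⟨j, hj, rfl⟩ := hx
  exact nacci_pos k j (hs j hj)

theorem block_card (k : ℕ) (s : Finset ℕ) : (nacciBlock 1 k s).card = s.card := by
  rw [block_eq, Multiset.card_map]; rfl

/-- Sum of squares of a position. -/
def sumSq (A : Multiset ℕ) : ℕ := (A.map (fun x => x * x)).sum

theorem sumSq_add (A B : Multiset ℕ) : sumSq (A + B) = sumSq A + sumSq B := by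
  simp [sumSq]

theorem sumSq_cons (a : ℕ) (B : Multiset ℕ) : sumSq (a ::ₘ B) = a * a + sumSq B := by
  simp [sumSq]

theorem sumSq_singleton (a : ℕ) : sumSq {a} = a * a := by
  simp [sumSq]

theorem sumSq_replicate (n a : ℕ) : sumSq (Multiset.replicate n a) = n * (a * a) := by
  simp [sumSq]

theorem sumSq_le (A : Multiset ℕ) : sumSq A ≤ A.sum * A.sum := by
  induction A using Multiset.induction_on with
  | empty => simp [sumSq]
  | cons a s ih =>
    rw [sumSq_cons, Multiset.sum_cons]
    nlinarith [Nat.zero_le (a * s.sum)]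

theorem sumSq_lt (A : Multiset ℕ) (hc : 2 ≤ A.card) (hpos : ∀ x ∈ A, 0 < x) :
    sumSq A < A.sum * A.sum := by
  obtain ⟨a, ha⟩ := Multiset.card_pos_iff_exists_mem.1 (show 0 < A.card by omega)
  obtain ⟨s, rfl⟩ := Multiset.exists_cons_of_mem ha
  rw [Multiset.card_cons] at hc
  obtain ⟨b, hb⟩ := Multiset.card_pos_iff_exists_mem.1 (show 0 < s.card by omega)
  have h1 := hpos a ha
  have h2 := hpos b (Multiset.mem_cons_of_mem hb)
  have h3 := Multiset.single_le_sum (fun x _ => Nat.zero_le x) b hb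
  have h4 := sumSq_le s
  rw [sumSq_cons, Multiset.sum_cons]
  have : 0 < a * s.sum := Nat.mul_pos h1 (by omega)
  nlinarith

/-! ### Normal form of a move -/

/-- Result of replacing `2, 2`. -/
def cQ (k : ℕ) : Multiset ℕ := if k = 1 then {nacci 1 k 3, 1} else {nacci 1 k 3}

/-- Result of replacing two copies of the third number. -/
def dQ (k : ℕ) : Multiset ℕ := if k ≤ 2 then {nacci 1 k 4, 1} else {nacci 1 k 4}

theorem nacci_three_gt (k : ℕ) (hk : 1 ≤ k) : 2 < nacci 1 k 3 := by
  have := nacci_lt k hk 2 3 (by omega) (by omega)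
  rwa [nacci_two' k hk] at this

theorem nacci_four_gt (k : ℕ) (hk : 1 ≤ k) : nacci 1 k 3 < nacci 1 k 4 :=
  nacci_lt k hk 3 4 (by omega) (by omega)

/-- What we need to know about a legal replacement of `R` by `R'`. -/
def GoodRule (k : ℕ) (R R' : Multiset ℕ) : Prop :=
  R.sum = R'.sum ∧ sumSq R < sumSq R' ∧ R.count 1 ≤ 2 ∧
    ((R = {2, 2} ∧ R' = cQ k) ∨ R.count 2 ≤ 1)

theorem goodRule_pair (k i : ℕ) (hk : 1 ≤ k) (hi : 1 ≤ i) (R' : Multiset ℕ)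
    (h2 : i = 2 → R' = cQ k)
    (hs : 2 * nacci 1 k i = R'.sum)
    (hq : 2 * (nacci 1 k i * nacci 1 k i) < sumSq R') :
    GoodRule k (Multiset.replicate (1 + 1) (nacci 1 k i)) R' := by
  refine ⟨by rw [← hs]; simp; omega, by rw [sumSq_replicate]; exact hq, ?_, ?_⟩
  · rw [Multiset.count_replicate]; split <;> omega
  · by_cases h : i = 2
    · left
      refine ⟨?_, h2 h⟩
      subst h
      rw [nacci_two' k hk]; rfl
    · right
      rw [Multiset.count_replicate, if_neg]
      · omega
      · intro h'
        apply h
        apply nacci_inj k hk i 2 hi (by omega)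
        rw [nacci_two' k hk]; exact h'

theorem move_normal (k : ℕ) (hk : 1 ≤ k) (A B : Multiset ℕ) (h : CkMove 1 k A B) :
    ∃ X R R', A = X + R ∧ B = X + R' ∧ GoodRule k R R' := by
  suffices H : ∃ R R', R ≤ A ∧ B = A - R + R' ∧ GoodRule k R R' by
    obtain ⟨R, R', h1, h2, h3⟩ := H
    exact ⟨A - R, R, R', (tsub_add_cancel_of_le h1).symm, h2, h3⟩
  have two_of_sq : ∀ a b c : ℕ, 2 * a = b + c → a < b → 2 * (a * a) < b * b + c * c := by
    intro a b c h1 h2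
    obtain ⟨e, rfl⟩ := Nat.exists_eq_add_of_lt h2
    have : a = e + 1 + c := by omega
    subst this
    nlinarith
  rcases h with ⟨i, hi, hle, hB⟩ | ⟨i, h2, hi, hle, hB⟩ | ⟨hle, hB⟩ | ⟨i, h1, hi, hle, hB⟩ |
    ⟨hle, hB⟩ | ⟨i, hi, hle, hB⟩
  · refine ⟨_, _, hle, hB, ?_⟩
    have hs : ∀ j ∈ Finset.Icc (i - k) i, 1 ≤ j := by
      intro j hj; rw [Finset.mem_Icc] at hj; omega
    have hsum : (nacciBlock 1 k (Finset.Icc (i - k) i)).sum = nacci 1 k (i + 1) := by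
      rw [block_sum, nacci_rec_high k i hi]
    refine ⟨by rw [hsum]; simp, ?_, ?_, Or.inr (block_count k hk _ hs 2)⟩
    · rw [sumSq_singleton, ← hsum]
      apply sumSq_lt _ _ (block_pos k _ hs)
      rw [block_card, Nat.card_Icc]; omega
    · exact (block_count k hk _ hs 1).trans (by omega)
  · refine ⟨_, _, hle, hB, ?_⟩
    have hs : ∀ j ∈ Finset.Icc 2 i, 1 ≤ j := by
      intro j hj; rw [Finset.mem_Icc] at hj; omega
    have hsum : (Multiset.replicate (1 + 1) (nacci 1 k 1) +
        nacciBlock 1 k (Finset.Icc 2 i)).sum = nacci 1 k (i + 1) := by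
      rw [Multiset.sum_add, block_sum, nacci_sum_low k i h2 hi]; simp; omega
    refine ⟨by rw [hsum]; simp, ?_, ?_, Or.inr ?_⟩
    · rw [sumSq_singleton, ← hsum]
      apply sumSq_lt
      · simp
      · intro x hx
        rw [Multiset.mem_add] at hx
        rcases hx with hx | hx
        · rw [Multiset.eq_of_mem_replicate hx]; exact nacci_pos k 1 le_rfl
        · exact block_pos k _ hs x hx
    · rw [Multiset.count_add, nacci_one']
      have : (nacciBlock 1 k (Finset.Icc 2 i)).count 1 = 0 := by
        rw [Multiset.count_eq_zero, block_eq, Multiset.mem_map]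
        rintro ⟨j, hj, hj'⟩
        have hj2 : 2 ≤ j := (Finset.mem_Icc.1 hj).1
        have := nacci_lt k hk 1 j le_rfl (by omega)
        rw [nacci_one'] at this
        omega
      rw [this]; simp
    · rw [Multiset.count_add, nacci_one']
      have := block_count k hk _ hs 2
      simp [Multiset.count_replicate]
      exact this
  · refine ⟨_, _, hle, hB, goodRule_pair k 1 hk le_rfl _ (by omega) ?_ ?_⟩
    · simp [nacci_one', nacci_two' k hk]
    · simp [sumSq_singleton, nacci_one', nacci_two' k hk]
  · refine ⟨_, _, hle, hB, goodRule_pair k i hk (by omega) _ ?_ ?_ ?_⟩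
    · rintro rfl
      rw [cQ, if_neg (by omega)]
    · simp [nacci_double k i (by omega) (by omega)]
    · rw [sumSq_singleton, nacci_double k i (by omega) (by omega)]
      have := nacci_pos k i (by omega)
      nlinarith
  · refine ⟨_, _, hle, hB, goodRule_pair k (k + 1) hk (by omega) _ ?_ ?_ ?_⟩
    · intro h
      have : k = 1 := by omega
      subst this
      rw [cQ, if_pos rfl, nacci_one']
    · simpa using nacci_split_base k hk
    · rw [Multiset.insert_eq_cons, sumSq_cons, sumSq_singleton]
      exact two_of_sq _ _ _ (nacci_split_base k hk) (nacci_lt_succ k hk _ (by omega))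
  · refine ⟨_, _, hle, hB, goodRule_pair k i hk (by omega) _ (by omega) ?_ ?_⟩
    · simpa using nacci_split_high k i hi
    · rw [sumSq_add, sumSq_singleton, sumSq_replicate, one_mul]
      exact two_of_sq _ _ _ (nacci_split_high k i hi) (nacci_lt_succ k hk _ (by omega))

/-! ### Particular moves -/

theorem move_a (k : ℕ) (hk : 1 ≤ k) (X : Multiset ℕ) : CkMove 1 k (X + {1, 1}) (X + {2}) := by
  right; right; left
  have e : Multiset.replicate (1 + 1) (nacci 1 k 1) = {1, 1} := by rw [nacci_one']; rfl
  rw [e, nacci_two' k hk, add_tsub_cancel_right]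
  exact ⟨Multiset.le_add_left _ _, rfl⟩

theorem move_c (k : ℕ) (hk : 1 ≤ k) (X : Multiset ℕ) : CkMove 1 k (X + {2, 2}) (X + cQ k) := by
  have e : Multiset.replicate (1 + 1) (nacci 1 k 2) = {2, 2} := by rw [nacci_two' k hk]; rfl
  by_cases h : k = 1
  · subst h
    right; right; right; right; left
    rw [e, add_tsub_cancel_right, nacci_one', cQ, if_pos rfl]
    exact ⟨Multiset.le_add_left _ _, rfl⟩
  · right; right; right; left
    refine ⟨2, by omega, by omega, ?_, ?_⟩
    · rw [e]; exact Multiset.le_add_left _ _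
    · rw [e, add_tsub_cancel_right, cQ, if_neg h]

theorem move_b (k : ℕ) (hk : 1 ≤ k) (X : Multiset ℕ) :
    CkMove 1 k (X + {2, 1, 1}) (X + cQ k) := by
  by_cases h : k = 1
  · subst h
    left
    refine ⟨2, le_rfl, ?_⟩
    have e : nacciBlock 1 1 (Finset.Icc (2 - 1) 2) = {1, 2} := by
      rw [block_eq, show (Finset.Icc (2 - 1) 2).val = ({1, 2} : Multiset ℕ) from by decide]
      simp [nacci_one', nacci_two']
    have e2 : X + {2, 1, 1} = (X + {1}) + {1, 2} := by
      simp only [Multiset.insert_eq_cons, ← Multiset.singleton_add]; abel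
    rw [e, e2, add_tsub_cancel_right, cQ, if_pos rfl]
    refine ⟨Multiset.le_add_left _ _, ?_⟩
    rw [add_assoc]; congr 1
    rw [Multiset.singleton_add, Multiset.pair_comm]; rfl
  · right; left
    refine ⟨2, le_rfl, by omega, ?_⟩
    have e : Multiset.replicate (1 + 1) (nacci 1 k 1) + nacciBlock 1 k (Finset.Icc 2 2)
        = {2, 1, 1} := by
      rw [block_eq, nacci_one']
      simp [nacci_two' k hk]
      decide
    rw [e, add_tsub_cancel_right, cQ, if_neg h]
    exact ⟨Multiset.le_add_left _ _, rfl⟩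

theorem move_d (k : ℕ) (hk : 1 ≤ k) (X : Multiset ℕ) :
    CkMove 1 k (X + {nacci 1 k 3, nacci 1 k 3}) (X + dQ k) := by
  have e : Multiset.replicate (1 + 1) (nacci 1 k 3) = {nacci 1 k 3, nacci 1 k 3} := rfl
  by_cases h1 : k = 1
  · subst h1
    right; right; right; right; right
    refine ⟨3, by omega, ?_, ?_⟩
    · rw [e]; exact Multiset.le_add_left _ _
    · rw [e, add_tsub_cancel_right, dQ, if_pos (by omega)]
      congr 1
      simp [nacci_one']
  by_cases h2 : k = 2
  · subst h2
    right; right; right; right; left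
    refine ⟨?_, ?_⟩
    · rw [e]; exact Multiset.le_add_left _ _
    · rw [e, add_tsub_cancel_right, dQ, if_pos (by omega), nacci_one']
  · right; right; right; left
    refine ⟨3, by omega, by omega, ?_, ?_⟩
    · rw [e]; exact Multiset.le_add_left _ _
    · rw [e, add_tsub_cancel_right, dQ, if_neg (by omega)]

theorem move_e (k : ℕ) (hk : 1 ≤ k) (X : Multiset ℕ) :
    CkMove 1 k (X + {nacci 1 k 3, nacci 1 k 3} + {2} + {1, 1}) (X + dQ k + cQ k) := by
  by_cases h1 : k = 1
  · subst h1
    left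
    refine ⟨3, by omega, ?_⟩
    have e : nacciBlock 1 1 (Finset.Icc (3 - 1) 3) = {2} + {nacci 1 1 3} := by
      rw [block_eq, show (Finset.Icc (3 - 1) 3).val = ({2, 3} : Multiset ℕ) from by decide]
      simp [nacci_two']
    have e2 : X + {nacci 1 1 3, nacci 1 1 3} + {2} + {1, 1}
        = (X + {nacci 1 1 3} + {1, 1}) + ({2} + {nacci 1 1 3}) := by
      simp only [Multiset.insert_eq_cons, ← Multiset.singleton_add]; abel
    rw [e, e2, add_tsub_cancel_right, cQ, if_pos rfl, dQ, if_pos (by omega)]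
    refine ⟨Multiset.le_add_left _ _, ?_⟩
    simp only [Multiset.insert_eq_cons, ← Multiset.singleton_add]; abel
  by_cases h2 : k = 2
  · subst h2
    left
    refine ⟨3, by omega, ?_⟩
    have e : nacciBlock 1 2 (Finset.Icc (3 - 2) 3) = {1} + {2} + {nacci 1 2 3} := by
      rw [block_eq, show (Finset.Icc (3 - 2) 3).val = ({1, 2, 3} : Multiset ℕ) from by decide]
      simp [nacci_two', nacci_one']
    have e2 : X + {nacci 1 2 3, nacci 1 2 3} + {2} + {1, 1}
        = (X + {nacci 1 2 3} + {1}) + ({1} + {2} + {nacci 1 2 3}) := by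
      simp only [Multiset.insert_eq_cons, ← Multiset.singleton_add]; abel
    rw [e, e2, add_tsub_cancel_right, cQ, if_neg (by omega), dQ, if_pos (by omega)]
    refine ⟨Multiset.le_add_left _ _, ?_⟩
    simp only [Multiset.insert_eq_cons, ← Multiset.singleton_add]; abel
  · right; left
    refine ⟨3, by omega, by omega, ?_⟩
    have e : Multiset.replicate (1 + 1) (nacci 1 k 1) + nacciBlock 1 k (Finset.Icc 2 3)
        = {1, 1} + ({2} + {nacci 1 k 3}) := by
      rw [block_eq, show (Finset.Icc 2 3).val = ({2, 3} : Multiset ℕ) from by decide, nacci_one']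
      simp [nacci_two' k hk]
    have e2 : X + {nacci 1 k 3, nacci 1 k 3} + {2} + {1, 1}
        = (X + {nacci 1 k 3}) + ({1, 1} + ({2} + {nacci 1 k 3})) := by
      simp only [Multiset.insert_eq_cons, ← Multiset.singleton_add]; abel
    rw [e, e2, add_tsub_cancel_right, cQ, if_neg (by omega), dQ, if_neg (by omega)]
    refine ⟨Multiset.le_add_left _ _, ?_⟩
    abel

/-! ### Effect of an arbitrary move -/

theorem move_effect (k : ℕ) (hk : 1 ≤ k) (A B : Multiset ℕ) (h : CkMove 1 k A B) :
    A.count 1 ≤ B.count 1 + 2 ∧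
    ((∃ X, A = X + {2, 2} ∧ B = X + cQ k) ∨ A.count 2 ≤ B.count 2 + 1) := by
  obtain ⟨X, R, R', rfl, rfl, -, -, h1, h2⟩ := move_normal k hk A B h
  refine ⟨by simp only [Multiset.count_add]; omega, ?_⟩
  rcases h2 with ⟨rfl, rfl⟩ | h2
  · exact Or.inl ⟨X, rfl, rfl⟩
  · right; simp only [Multiset.count_add]; omega

theorem move_effect' (k : ℕ) (hk : 1 ≤ k) (A B : Multiset ℕ) (h : CkMove 1 k A B) :
    A.count 1 ≤ B.count 1 + 2 ∧
    (A.count 2 ≤ B.count 2 + 1 ∨ (A.count 2 = B.count 2 + 2 ∧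
      B.count (nacci 1 k 3) = A.count (nacci 1 k 3) + 1 ∧ A.count 1 ≤ B.count 1)) := by
  obtain ⟨h1, ⟨X, rfl, rfl⟩ | h2⟩ := move_effect k hk A B h
  · refine ⟨h1, Or.inr ?_⟩
    have h3 := nacci_three_gt k hk
    have n1 : nacci 1 k 3 ≠ 1 := by omega
    have n2 : nacci 1 k 3 ≠ 2 := by omega
    unfold cQ
    split_ifs <;>
      simp [Multiset.insert_eq_cons, Multiset.count_cons, Multiset.count_singleton, n1, n2, n1.symm,
        n2.symm]
  · exact ⟨h1, Or.inl h2⟩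

theorem move_sum (k : ℕ) (hk : 1 ≤ k) (A B : Multiset ℕ) (h : CkMove 1 k A B) :
    A.sum = B.sum ∧ sumSq A < sumSq B := by
  obtain ⟨X, R, R', rfl, rfl, h1, h2, -⟩ := move_normal k hk A B h
  simp only [Multiset.sum_add, sumSq_add]
  omega

/-! ### Losing positions for the big team -/

/-- Positions from which `team` cannot force a win (including finished games whose last
mover is not in the team). -/
def Lost (Move : Multiset ℕ → Multiset ℕ → Prop) (p : ℕ) (team : ℕ → Prop)
    (t : ℕ) (X : Multiset ℕ) : Prop :=
  ¬ AllianceWins Move p team t X ∧ (Terminal Move X → 0 < t ∧ ¬ team ((t - 1) % p + 1))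

section game
variable {Move : Multiset ℕ → Multiset ℕ → Prop} {p : ℕ} {team : ℕ → Prop}

theorem Lost.big {t : ℕ} {X Y : Multiset ℕ} (h : Lost Move p team t X)
    (ht : team (t % p + 1)) (hm : Move X Y) : Lost Move p team (t + 1) Y :=
  ⟨fun hw => h.1 (.contMove t X Y ht hm hw), fun hT => absurd (.endMove t X Y ht hm hT) h.1⟩

theorem Lost.any {t : ℕ} {X : Multiset ℕ} (h : Lost Move p team t X)
    (hm : ∃ Y, Move X Y) : ∃ Y, Move X Y ∧ Lost Move p team (t + 1) Y := by
  by_cases ht : team (t % p + 1)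
  · obtain ⟨Y, hY⟩ := hm
    exact ⟨Y, hY, h.big ht hY⟩
  · by_contra! hc
    apply h.1
    refine .oppMove t X ht hm (fun B hB => ?_)
    by_contra hw
    exact hc B hB ⟨hw, fun _ => ⟨by omega, by simpa using ht⟩⟩

end game

theorem lost_sync (k : ℕ) (hk : 1 ≤ k) (p d : ℕ) (team : ℕ → Prop)
    (hd : ∀ u, team (u % p + 1) ∨ team ((u + d) % p + 1)) :
    ∀ (m : ℕ) (X : Multiset ℕ), X.sum * X.sum - sumSq X = m → ∀ t,
      Lost (CkMove 1 k) p team t X → Lost (CkMove 1 k) p team (t + d) X → False := by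
  intro m
  induction m using Nat.strong_induction_on with
  | _ m ih =>
    intro X hX t h1 h2
    by_cases hT : Terminal (CkMove 1 k) X
    · have a1 := h1.2 hT
      have a2 := h2.2 hT
      rcases hd (t - 1) with h | h
      · exact a1.2 h
      · apply a2.2
        rwa [show t + d - 1 = t - 1 + d by omega]
    · have hm : ∃ Y, CkMove 1 k X Y := by
        unfold Terminal at hT; push Not at hT; exact hT
      have key : ∀ Y, CkMove 1 k X Y → Lost (CkMove 1 k) p team (t + 1) Y →
          Lost (CkMove 1 k) p team (t + d + 1) Y → False := by
        intro Y hY l1 l2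
        obtain ⟨e1, e2⟩ := move_sum k hk X Y hY
        have e3 := sumSq_le Y
        refine ih (Y.sum * Y.sum - sumSq Y) ?_ Y rfl (t + 1) l1 ?_
        · rw [← hX, e1]; omega
        · rwa [show t + 1 + d = t + d + 1 by omega]
      rcases hd t with h | h
      · obtain ⟨Y, hY, l2⟩ := h2.any hm
        exact key Y hY (h1.big h hY) l2
      · obtain ⟨Y, hY, l1⟩ := h1.any hm
        exact key Y hY l1 (h2.big h hY)

/-! ### Extracting copies -/

theorem take_copies (A : Multiset ℕ) (v m : ℕ) (h : m ≤ A.count v) :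
    ∃ X, A = X + Multiset.replicate m v :=
  ⟨A - Multiset.replicate m v,
    (tsub_add_cancel_of_le (Multiset.le_count_iff_replicate_le.1 h)).symm⟩

theorem exists_move (k : ℕ) (hk : 1 ≤ k) (A : Multiset ℕ) (h : 2 ≤ A.count 1) :
    ∃ B, CkMove 1 k A B := by
  obtain ⟨X, rfl⟩ := take_copies A 1 2 h
  exact ⟨_, move_a k hk X⟩

section strategies
variable {k p : ℕ} {team : ℕ → Prop}

theorem Lost.stepA (hk : 1 ≤ k) {t : ℕ} {A : Multiset ℕ}
    (h : Lost (CkMove 1 k) p team t A) (ht : team (t % p + 1)) (h1 : 2 ≤ A.count 1) :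
    ∃ B, Lost (CkMove 1 k) p team (t + 1) B ∧ B.count 1 + 2 = A.count 1 ∧
      B.count 2 = A.count 2 + 1 ∧ B.count (nacci 1 k 3) = A.count (nacci 1 k 3) := by
  obtain ⟨X, rfl⟩ := take_copies A 1 2 h1
  have h3 := nacci_three_gt k hk
  have n1 : nacci 1 k 3 ≠ 1 := by omega
  have n2 : nacci 1 k 3 ≠ 2 := by omega
  refine ⟨X + {2}, h.big ht (move_a k hk X), ?_, ?_, ?_⟩ <;>
    simp [Multiset.count_replicate, Multiset.count_singleton, n1, n2, n1.symm]

theorem Lost.stepAny (hk : 1 ≤ k) {t : ℕ} {A : Multiset ℕ}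
    (h : Lost (CkMove 1 k) p team t A) (h1 : 2 ≤ A.count 1) :
    ∃ B, Lost (CkMove 1 k) p team (t + 1) B ∧ A.count 1 ≤ B.count 1 + 2 ∧
    (A.count 2 ≤ B.count 2 + 1 ∨ (A.count 2 = B.count 2 + 2 ∧
      B.count (nacci 1 k 3) = A.count (nacci 1 k 3) + 1 ∧ A.count 1 ≤ B.count 1)) := by
  obtain ⟨B, hB, hL⟩ := h.any (exists_move k hk A h1)
  exact ⟨B, hL, move_effect' k hk A B hB⟩

theorem Lost.wait (hk : 1 ≤ k) {n : ℕ}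
    (h : Lost (CkMove 1 k) p team 0 (Multiset.replicate n 1)) (m : ℕ) (hm : 2 * m ≤ n) :
    ∃ A, Lost (CkMove 1 k) p team m A ∧ n ≤ A.count 1 + 2 * m := by
  induction m with
  | zero => exact ⟨_, h, by simp⟩
  | succ m ih =>
    obtain ⟨A, hA, hc⟩ := ih (by omega)
    obtain ⟨B, hB, hc2, -⟩ := hA.stepAny hk (by omega)
    exact ⟨B, hB, by omega⟩

/-! Non-adjacent opponents: shift by one. -/

theorem win_two (hk : 1 ≤ k) (hd : ∀ u, team (u % p + 1) ∨ team ((u + 1) % p + 1))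
    (t : ℕ) (A : Multiset ℕ) (h : Lost (CkMove 1 k) p team t A)
    (b0 : team (t % p + 1)) (b1 : team ((t + 1) % p + 1))
    (h2 : 1 ≤ A.count 2) (h1 : 2 ≤ A.count 1) : False := by
  obtain ⟨Y, rfl⟩ := take_copies A 2 1 h2
  have : 2 ≤ Y.count 1 := by simpa [Multiset.count_singleton] using h1
  obtain ⟨X, rfl⟩ := take_copies Y 1 2 this
  have e1 : X + Multiset.replicate 2 1 + Multiset.replicate 1 2 = X + {2, 1, 1} := by
    simp only [Multiset.replicate_succ, Multiset.replicate_zero, Multiset.insert_eq_cons,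
      ← Multiset.singleton_add]; abel
  have e2 : X + Multiset.replicate 2 1 + Multiset.replicate 1 2 = X + {2} + {1, 1} := by
    simp only [Multiset.replicate_succ, Multiset.replicate_zero, Multiset.insert_eq_cons,
      ← Multiset.singleton_add]; abel
  have l1 := h.big b0 (e1 ▸ move_b k hk X)
  have l2 := h.big b0 (e2 ▸ move_a k hk (X + {2}))
  have e3 : X + {2} + {2} = X + {2, 2} := by rw [add_assoc]; rfl
  rw [e3] at l2
  have l3 := l2.big b1 (move_c k hk X)
  exact lost_sync k hk p 1 team hd _ _ rfl _ l1 l3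

theorem win_three (hk : 1 ≤ k) (hd : ∀ u, team (u % p + 1) ∨ team ((u + 1) % p + 1))
    (t : ℕ) (A : Multiset ℕ) (h : Lost (CkMove 1 k) p team t A)
    (b0 : team (t % p + 1)) (b1 : team ((t + 1) % p + 1)) (b2 : team ((t + 2) % p + 1))
    (h1 : 4 ≤ A.count 1) : False := by
  obtain ⟨B, hB, c1, c2, -⟩ := h.stepA hk b0 (by omega)
  exact win_two hk hd (t + 1) B hB b1 b2 (by omega) (by omega)

theorem win_two_two (hk : 1 ≤ k) (hd : ∀ u, team (u % p + 1) ∨ team ((u + 1) % p + 1))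
    (t : ℕ) (A : Multiset ℕ) (h : Lost (CkMove 1 k) p team t A)
    (b0 : team (t % p + 1)) (b1 : team ((t + 1) % p + 1))
    (b3 : team ((t + 3) % p + 1)) (b4 : team ((t + 4) % p + 1))
    (h1 : 8 ≤ A.count 1) : False := by
  by_cases h2 : 1 ≤ A.count 2
  · exact win_two hk hd t A h b0 b1 h2 (by omega)
  obtain ⟨X, rfl⟩ := take_copies A 1 4 (by omega)
  have e1 : X + Multiset.replicate 4 1 = X + {1, 1} + {1, 1} := by
    rw [add_assoc]; congr 1
  rw [e1] at h
  have l1 := h.big b0 (move_a k hk _)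
  have e2 : X + {1, 1} + {2} = X + {2} + {1, 1} := by abel
  have e3 : X + {2} + {1, 1} = X + {2, 1, 1} := by rw [add_assoc]; rfl
  have l2 := l1.big b1 ((e2.trans e3) ▸ move_b k hk X)
  rw [e2] at l1
  have l3 := l1.big b1 (move_a k hk _)
  have e4 : X + {2} + {2} = X + {2, 2} := by rw [add_assoc]; rfl
  rw [e4] at l3
  obtain ⟨Z, hZ, lZ⟩ := l3.any ⟨_, move_c k hk X⟩
  obtain ⟨c1, ⟨X', hX', rfl⟩ | c2⟩ := move_effect k hk _ _ hZ
  · have : X = X' := add_right_cancel hX'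
    subst this
    exact lost_sync k hk p 1 team hd _ _ rfl _ l2 lZ
  · simp [Multiset.insert_eq_cons, Multiset.count_cons, Multiset.count_singleton] at c1 c2 h1
    exact win_two hk hd (t + 3) Z lZ b3 b4 (by omega) (by omega)

/-! Adjacent opponents: shift by two. -/

theorem win_four (hk : 1 ≤ k) (hd : ∀ u, team (u % p + 1) ∨ team ((u + 2) % p + 1))
    (t : ℕ) (A : Multiset ℕ) (h : Lost (CkMove 1 k) p team t A)
    (b0 : team (t % p + 1)) (b1 : team ((t + 1) % p + 1))
    (b2 : team ((t + 2) % p + 1)) (b3 : team ((t + 3) % p + 1))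
    (h2 : 2 ≤ A.count 2) (h1 : 4 ≤ A.count 1) : False := by
  obtain ⟨Y, rfl⟩ := take_copies A 2 2 h2
  have : 4 ≤ Y.count 1 := by simpa [Multiset.count_replicate] using h1
  obtain ⟨X, rfl⟩ := take_copies Y 1 4 this
  have e0 : X + Multiset.replicate 4 1 + Multiset.replicate 2 2
      = X + {2, 1, 1} + {2, 1, 1} := by
    simp only [Multiset.replicate_succ, Multiset.replicate_zero, Multiset.insert_eq_cons,
      ← Multiset.singleton_add]; abel
  rw [e0] at h
  have l1 := h.big b0 (move_b k hk _)
  have e1 : X + {2, 1, 1} + cQ k = X + cQ k + {2, 1, 1} := by abel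
  rw [e1] at l1
  have l2 := l1.big b1 (move_b k hk _)
  have f1 : X + {2, 1, 1} + {2, 1, 1} = X + {2, 1, 1} + {2} + {1, 1} := by
    rw [add_assoc, add_assoc, add_assoc]; congr 1
  rw [f1] at h
  have m1 := h.big b0 (move_a k hk _)
  have f2 : X + {2, 1, 1} + {2} + {2} = X + {2, 2} + {2} + {1, 1} := by
    simp only [Multiset.insert_eq_cons, ← Multiset.singleton_add]; abel
  rw [f2] at m1
  have m2 := m1.big b1 (move_a k hk _)
  have f3 : X + {2, 2} + {2} + {2} = X + {2, 2} + {2, 2} := by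
    simp only [Multiset.insert_eq_cons, ← Multiset.singleton_add]; abel
  rw [f3] at m2
  have m3 := m2.big b2 (move_c k hk _)
  have f4 : X + {2, 2} + cQ k = X + cQ k + {2, 2} := by abel
  rw [f4] at m3
  have m4 := m3.big b3 (move_c k hk _)
  exact lost_sync k hk p 2 team hd _ _ rfl _ l2 m4

theorem win_four' (hk : 1 ≤ k) (hd : ∀ u, team (u % p + 1) ∨ team ((u + 2) % p + 1))
    (t : ℕ) (A : Multiset ℕ) (h : Lost (CkMove 1 k) p team t A)
    (b0 : team (t % p + 1)) (b1 : team ((t + 1) % p + 1))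
    (b2 : team ((t + 2) % p + 1)) (b3 : team ((t + 3) % p + 1))
    (h2 : 2 ≤ A.count (nacci 1 k 3)) (h1 : 4 ≤ A.count 1) : False := by
  have h3 := nacci_three_gt k hk
  have n1 : nacci 1 k 3 ≠ 1 := by omega
  obtain ⟨Y, rfl⟩ := take_copies A _ 2 h2
  have : 4 ≤ Y.count 1 := by
    rwa [Multiset.count_add, Multiset.count_replicate, if_neg n1, add_zero] at h1
  obtain ⟨X, rfl⟩ := take_copies Y 1 4 this
  have e0 : X + Multiset.replicate 4 1 + Multiset.replicate 2 (nacci 1 k 3)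
      = X + {nacci 1 k 3, nacci 1 k 3} + {1, 1} + {1, 1} := by
    simp only [Multiset.replicate_succ, Multiset.replicate_zero, Multiset.insert_eq_cons,
      ← Multiset.singleton_add]; abel
  rw [e0] at h
  have h := h.big b0 (move_a k hk _)
  have e1 : X + {nacci 1 k 3, nacci 1 k 3} + {1, 1} + {2}
      = X + {nacci 1 k 3, nacci 1 k 3} + {2} + {1, 1} := by abel
  rw [e1] at h
  have l := h.big b1 (move_e k hk X)
  have e2 : X + {nacci 1 k 3, nacci 1 k 3} + {2} + {1, 1}
      = X + {2} + {1, 1} + {nacci 1 k 3, nacci 1 k 3} := by abel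
  rw [e2] at h
  have m1 := h.big b1 (move_d k hk _)
  have e3 : X + {2} + {1, 1} + dQ k = X + dQ k + {2} + {1, 1} := by abel
  rw [e3] at m1
  have m2 := m1.big b2 (move_a k hk _)
  have e4 : X + dQ k + {2} + {2} = X + dQ k + {2, 2} := by rw [add_assoc]; rfl
  rw [e4] at m2
  have m3 := m2.big b3 (move_c k hk _)
  exact lost_sync k hk p 2 team hd _ _ rfl _ l m3

/-- Four big players all play `1, 1 → 2`, then two arbitrary moves are made. -/
theorem Lost.round (hk : 1 ≤ k) {t : ℕ} {A : Multiset ℕ}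
    (h : Lost (CkMove 1 k) p team t A)
    (b0 : team (t % p + 1)) (b1 : team ((t + 1) % p + 1))
    (b2 : team ((t + 2) % p + 1)) (b3 : team ((t + 3) % p + 1)) (h1 : 12 ≤ A.count 1) :
    ∃ B, Lost (CkMove 1 k) p team (t + 6) B ∧ A.count 1 ≤ B.count 1 + 12 ∧
      (2 ≤ B.count 2 ∨ (A.count 2 + 1 ≤ B.count 2 ∧ A.count 1 ≤ B.count 1 + 10) ∨
        2 ≤ B.count (nacci 1 k 3)) := by
  obtain ⟨A1, hA1, p1, q1, -⟩ := h.stepA hk b0 (by omega)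
  obtain ⟨A2, hA2, p2, q2, -⟩ := hA1.stepA hk b1 (by omega)
  obtain ⟨A3, hA3, p3, q3, -⟩ := hA2.stepA hk b2 (by omega)
  obtain ⟨A4, hA4, p4, q4, -⟩ := hA3.stepA hk b3 (by omega)
  obtain ⟨A5, hA5, p5, q5⟩ := hA4.stepAny hk (by omega)
  obtain ⟨A6, hA6, p6, q6⟩ := hA5.stepAny hk (by omega)
  exact ⟨A6, hA6, by omega, by omega⟩

theorem win_round_one (hk : 1 ≤ k) (hd : ∀ u, team (u % p + 1) ∨ team ((u + 2) % p + 1))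
    (t : ℕ) (A : Multiset ℕ) (h : Lost (CkMove 1 k) p team t A)
    (b0 : team (t % p + 1)) (b1 : team ((t + 1) % p + 1))
    (b2 : team ((t + 2) % p + 1)) (b3 : team ((t + 3) % p + 1))
    (b6 : team ((t + 6) % p + 1)) (b7 : team ((t + 7) % p + 1))
    (b8 : team ((t + 8) % p + 1)) (b9 : team ((t + 9) % p + 1))
    (h2 : 1 ≤ A.count 2) (h1 : 16 ≤ A.count 1) : False := by
  obtain ⟨B, hB, c1, c2⟩ := h.round hk b0 b1 b2 b3 (by omega)
  by_cases c3 : 2 ≤ B.count (nacci 1 k 3)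
  · exact win_four' hk hd (t + 6) B hB b6 b7 b8 b9 c3 (by omega)
  · exact win_four hk hd (t + 6) B hB b6 b7 b8 b9 (by omega) (by omega)

theorem win_round_zero (hk : 1 ≤ k) (hd : ∀ u, team (u % p + 1) ∨ team ((u + 2) % p + 1))
    (t : ℕ) (A : Multiset ℕ) (h : Lost (CkMove 1 k) p team t A)
    (b0 : team (t % p + 1)) (b1 : team ((t + 1) % p + 1))
    (b2 : team ((t + 2) % p + 1)) (b3 : team ((t + 3) % p + 1))
    (b6 : team ((t + 6) % p + 1)) (b7 : team ((t + 7) % p + 1))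
    (b8 : team ((t + 8) % p + 1)) (b9 : team ((t + 9) % p + 1))
    (b12 : team ((t + 12) % p + 1)) (b13 : team ((t + 13) % p + 1))
    (b14 : team ((t + 14) % p + 1)) (b15 : team ((t + 15) % p + 1))
    (h1 : 26 ≤ A.count 1) : False := by
  obtain ⟨B, hB, c1, c2⟩ := h.round hk b0 b1 b2 b3 (by omega)
  by_cases c3 : 2 ≤ B.count (nacci 1 k 3)
  · exact win_four' hk hd (t + 6) B hB b6 b7 b8 b9 c3 (by omega)
  by_cases c4 : 2 ≤ B.count 2
  · exact win_four hk hd (t + 6) B hB b6 b7 b8 b9 c4 (by omega)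
  · exact win_round_one hk hd (t + 6) B hB b6 b7 b8 b9 b12 b13 b14 b15 (by omega) (by omega)

theorem win_six (hk : 1 ≤ k) (hd : ∀ u, team (u % p + 1) ∨ team ((u + 2) % p + 1))
    (t : ℕ) (A : Multiset ℕ) (h : Lost (CkMove 1 k) p team t A)
    (hb : ∀ j, j < 6 → team ((t + j) % p + 1)) (h1 : 8 ≤ A.count 1) : False := by
  obtain ⟨A1, hA1, p1, q1, -⟩ := h.stepA hk (hb 0 (by omega)) (by omega)
  obtain ⟨A2, hA2, p2, q2, -⟩ := hA1.stepA hk (hb 1 (by omega)) (by omega)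
  exact win_four hk hd (t + 2) A2 hA2 (hb 2 (by omega)) (hb 3 (by omega)) (hb 4 (by omega))
    (hb 5 (by omega)) (by omega) (by omega)

end strategies

/-- The two opponents. -/
theorem exists_opponents (p : ℕ) (hp : 6 ≤ p) (big : Finset ℕ) (hbig : big ⊆ Finset.Icc 1 p)
    (hcard : big.card = p - 2) :
    ∃ s r, s < r ∧ r < p ∧ ∀ u, u % p ≠ s → u % p ≠ r → u % p + 1 ∈ big := by
  have hc : (Finset.Icc 1 p \ big).card = 2 := by
    rw [Finset.card_sdiff_of_subset hbig, hcard, Nat.card_Icc]; omega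
  obtain ⟨a, b, hab, he⟩ := Finset.card_eq_two.1 hc
  have ha : a ∈ Finset.Icc 1 p \ big := by rw [he]; simp
  have hb : b ∈ Finset.Icc 1 p \ big := by rw [he]; simp
  have ha' := Finset.mem_Icc.1 (Finset.mem_sdiff.1 ha).1
  have hb' := Finset.mem_Icc.1 (Finset.mem_sdiff.1 hb).1
  have key : ∀ u, u % p + 1 ≠ a → u % p + 1 ≠ b → u % p + 1 ∈ big := by
    intro u h1 h2
    by_contra h
    have hlt : u % p < p := Nat.mod_lt _ (by omega)
    have : u % p + 1 ∈ Finset.Icc 1 p \ big :=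
      Finset.mem_sdiff.2 ⟨Finset.mem_Icc.2 ⟨by omega, by omega⟩, h⟩
    rw [he] at this
    simp only [Finset.mem_insert, Finset.mem_singleton] at this
    omega
  rcases lt_or_gt_of_ne hab with h | h
  · exact ⟨a - 1, b - 1, by omega, by omega, fun u h1 h2 => key u (by omega) (by omega)⟩
  · exact ⟨b - 1, a - 1, by omega, by omega, fun u h1 h2 => key u (by omega) (by omega)⟩

theorem mod_low (p u : ℕ) (h : u < 2 * p) : (u < p ∧ u % p = u) ∨ (p ≤ u ∧ u % p = u - p) := by
  by_cases hu : u < p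
  · exact Or.inl ⟨hu, Nat.mod_eq_of_lt hu⟩
  · exact Or.inr ⟨by omega, by rw [Nat.mod_eq_sub_mod (by omega), Nat.mod_eq_of_lt (by omega)]⟩

theorem mod_shift (p u d : ℕ) (hd : d < p) :
    u % p < p ∧ ((u + d) % p = u % p + d ∨ ((u + d) % p = u % p + d - p ∧ p ≤ u % p + d)) := by
  have hlt : u % p < p := Nat.mod_lt _ (by omega)
  refine ⟨hlt, ?_⟩
  rw [← Nat.mod_add_mod]
  rcases mod_low p (u % p + d) (by omega) with h | h <;> omega

/-- Let `p ≥ 6`, `c = 1`, and `k ≥ 1`, and consider the team `(1,k)`-nacci Zeckendorf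
game on `n` with `p` players partitioned into exactly two teams, one with `p - 2` players
and the other with `2` players.  Then for every `n ≥ 36`, the team with `p - 2` players
has a winning strategy. -/
theorem team_one_k_nacci_large_team_wins (k p n : ℕ)
    (hk : 1 ≤ k) (hp : 6 ≤ p) (hn : 36 ≤ n)
    (big : Finset ℕ) (hbig : big ⊆ Finset.Icc 1 p) (hcard : big.card = p - 2) :
    AllianceWins (CkMove 1 k) p (fun q => q ∈ big) 0 (Multiset.replicate n 1) := by
  by_contra hcon
  have hL : Lost (CkMove 1 k) p (fun q => q ∈ big) 0 (Multiset.replicate n 1) := by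
    refine ⟨hcon, fun hT => ?_⟩
    obtain ⟨B, hB⟩ := exists_move k hk (Multiset.replicate n 1) (by simp; omega)
    exact absurd hB (hT B)
  obtain ⟨s, r, hsr, hrp, hteam⟩ := exists_opponents p hp big hbig hcard
  have hlow : ∀ u, u < 2 * p → u ≠ s → u ≠ r → u ≠ s + p → u ≠ r + p → u % p + 1 ∈ big := by
    intro u h0 h1 h2 h3 h4
    apply hteam <;> rcases mod_low p u h0 with h | h <;> omega
  by_cases hadj : r = s + 1 ∨ (s = 0 ∧ r = p - 1)
  · have hd : ∀ u, u % p + 1 ∈ big ∨ (u + 2) % p + 1 ∈ big := by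
      intro u
      by_contra! hc
      have h1 : u % p = s ∨ u % p = r := by
        by_contra! h; exact hc.1 (hteam u h.1 h.2)
      have h2 : (u + 2) % p = s ∨ (u + 2) % p = r := by
        by_contra! h; exact hc.2 (hteam _ h.1 h.2)
      have := mod_shift p u 2 (by omega)
      omega
    have hp' : p = 6 ∨ p = 7 ∨ 8 ≤ p := by omega
    rcases hp' with rfl | rfl | hp8
    · obtain ⟨T, hT5, hT⟩ : ∃ T, T ≤ 5 ∧
          ((r = s + 1 ∧ T = (s + 2) % 6) ∨ (s = 0 ∧ r = 5 ∧ T = 1)) := by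
        rcases hadj with h | h
        · exact ⟨(s + 2) % 6, by omega, Or.inl ⟨h, rfl⟩⟩
        · exact ⟨1, by omega, Or.inr ⟨h.1, by omega, rfl⟩⟩
      obtain ⟨A, hA, hc⟩ := hL.wait hk T (by omega)
      refine win_round_zero hk hd T A hA ?_ ?_ ?_ ?_ ?_ ?_ ?_ ?_ ?_ ?_ ?_ ?_ (by omega) <;>
        exact hteam _ (by omega) (by omega)
    · obtain ⟨T, hT6, hT⟩ : ∃ T, T ≤ 6 ∧
          ((r = s + 1 ∧ T = (s + 2) % 7) ∨ (s = 0 ∧ r = 6 ∧ T = 1)) := by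
        rcases hadj with h | h
        · exact ⟨(s + 2) % 7, by omega, Or.inl ⟨h, rfl⟩⟩
        · exact ⟨1, by omega, Or.inr ⟨h.1, by omega, rfl⟩⟩
      obtain ⟨A, hA, hc⟩ := hL.wait hk T (by omega)
      obtain ⟨B, hB, c1, c2, -⟩ := hA.stepA hk (hteam _ (by omega) (by omega)) (by omega)
      refine win_round_one hk hd (T + 1) B hB ?_ ?_ ?_ ?_ ?_ ?_ ?_ ?_ (by omega) (by omega) <;>
        exact hteam _ (by omega) (by omega)
    · obtain ⟨T, hT⟩ : ∃ T, (r = s + 1 ∧ 6 ≤ s ∧ T = 0) ∨ (r = s + 1 ∧ s ≤ 5 ∧ T = s + 2) ∨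
          (s = 0 ∧ r = p - 1 ∧ T = 1) := by
        rcases hadj with h | h
        · by_cases h6 : 6 ≤ s
          · exact ⟨0, Or.inl ⟨h, h6, rfl⟩⟩
          · exact ⟨s + 2, Or.inr (Or.inl ⟨h, by omega, rfl⟩)⟩
        · exact ⟨1, Or.inr (Or.inr ⟨h.1, h.2, rfl⟩)⟩
      obtain ⟨A, hA, hc⟩ := hL.wait hk T (by omega)
      refine win_six hk hd T A hA (fun j hj => hlow _ ?_ ?_ ?_ ?_ ?_) ?_ <;> omega
  · have hd : ∀ u, u % p + 1 ∈ big ∨ (u + 1) % p + 1 ∈ big := by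
      intro u
      by_contra! hc
      have h1 : u % p = s ∨ u % p = r := by
        by_contra! h; exact hc.1 (hteam u h.1 h.2)
      have h2 : (u + 1) % p = s ∨ (u + 1) % p = r := by
        by_contra! h; exact hc.2 (hteam _ h.1 h.2)
      have := mod_shift p u 1 (by omega)
      omega
    by_cases h22 : p = 6 ∧ r = s + 3
    · obtain ⟨rfl, rfl⟩ := h22
      obtain ⟨A, hA, hc⟩ := hL.wait hk (s + 1) (by omega)
      refine win_two_two hk hd (s + 1) A hA ?_ ?_ ?_ ?_ (by omega) <;>
        exact hteam _ (by omega) (by omega)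
    · obtain ⟨T, hT⟩ : ∃ T, (3 ≤ s ∧ T = 0) ∨ (s ≤ 2 ∧ s + 4 ≤ r ∧ T = s + 1) ∨
          (s ≤ 2 ∧ r ≤ s + 3 ∧ T = r + 1) := by
        by_cases h3 : 3 ≤ s
        · exact ⟨0, Or.inl ⟨h3, rfl⟩⟩
        by_cases h4 : s + 4 ≤ r
        · exact ⟨s + 1, Or.inr (Or.inl ⟨by omega, h4, rfl⟩)⟩
        · exact ⟨r + 1, Or.inr (Or.inr ⟨by omega, by omega, rfl⟩)⟩
      obtain ⟨A, hA, hc⟩ := hL.wait hk T (by omega)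
      refine win_three hk hd T A hA ?_ ?_ ?_ (by omega) <;>
        apply hlow <;> omega
end
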